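/- Under assumption (H_{A,μ}) and with the choice of weights (γ_i), for every bounded Lipschitz function f : H → ℝ and every R > 0 one has lim_{α→∞} sup_{x ∈ {V ≤ R}} |α U_α f(x) − f(x)| = 0, where U_α f(x) := ∫_0^∞ e^{−α t} ∫_H f(T_t x + y) μ_t(dy) dt and {V ≤ R} := {x ∈ H : V(x) ≤ R}. -/

import Mathlib

open MeasureTheory Filter
open scoped ENNReal Topology RealInnerProductSpace

/-- The lower Lebesgue integral is countably superadditive, without measurability. -/
lemma tsum_lintegral_le_lintegral_tsum {Ω : Type*} [MeasurableSpace Ω] (ν : Measure Ω)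
    (F : ℕ → Ω → ℝ≥0∞) : ∑' i, ∫⁻ ω, F i ω ∂ν ≤ ∫⁻ ω, ∑' i, F i ω ∂ν := by
  rw [ENNReal.tsum_eq_iSup_sum]
  refine iSup_le fun s => ?_
  have h : ∑ i ∈ s, ∫⁻ ω, F i ω ∂ν ≤ ∫⁻ ω, ∑ i ∈ s, F i ω ∂ν := by
    classical
    induction s using Finset.induction_on with
    | empty => simp
    | insert j s hj ih =>
      simp only [Finset.sum_insert hj]
      exact (add_le_add le_rfl ih).trans (le_lintegral_add _ _)
  exact h.trans (lintegral_mono fun ω => ENNReal.sum_le_tsum s)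

lemma aemeasurable_lintegral_of_weakly_continuous {H : Type*} [TopologicalSpace H]
    [MeasurableSpace H] [BorelSpace H] (μ : ℝ → Measure H) [∀ t, IsProbabilityMeasure (μ t)]
    (hμw : ∀ f : H → ℝ, Continuous f → (∃ C, ∀ x, |f x| ≤ C) →
      ContinuousOn (fun t => ∫ y, f y ∂ μ t) (Set.Ici (0 : ℝ)))
    (φ : H → ℝ) (hφ : Continuous φ) (hφ0 : ∀ y, 0 ≤ φ y) :
    AEMeasurable (fun t => ∫⁻ y, ENNReal.ofReal (φ y) ∂ μ t)
      (volume.restrict (Set.Ioi (0 : ℝ))) := by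
  have hb : ∀ (n : ℕ) (y : H), |min (φ y) n| ≤ n := fun n y => by
    rw [abs_of_nonneg (le_min (hφ0 y) n.cast_nonneg)]
    exact min_le_right _ _
  have htrunc : ∀ n : ℕ, Continuous fun y => min (φ y) (n : ℝ) := fun n =>
    hφ.min continuous_const
  have hrepr : (fun t => ∫⁻ y, ENNReal.ofReal (φ y) ∂ μ t)
      = fun t => ⨆ n : ℕ, ENNReal.ofReal (∫ y, min (φ y) (n : ℝ) ∂ μ t) := by
    funext t
    have h1 : ∀ n : ℕ, ENNReal.ofReal (∫ y, min (φ y) (n : ℝ) ∂ μ t)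
        = ∫⁻ y, ENNReal.ofReal (min (φ y) (n : ℝ)) ∂ μ t := fun n =>
      ofReal_integral_eq_lintegral_ofReal
        (Integrable.of_bound (htrunc n).measurable.aestronglyMeasurable n
          (Eventually.of_forall fun y => by simpa using hb n y))
        (Eventually.of_forall fun y => le_min (hφ0 y) n.cast_nonneg)
    simp_rw [h1]
    rw [← lintegral_iSup]
    · refine lintegral_congr fun y => le_antisymm ?_ ?_
      · obtain ⟨n, hn⟩ := exists_nat_ge (φ y)
        exact le_iSup_of_le n (by rw [min_eq_left hn])
      · exact iSup_le fun n => ENNReal.ofReal_le_ofReal (min_le_left _ _)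
    · exact fun n => (htrunc n).measurable.ennreal_ofReal
    · exact fun m n hmn y => ENNReal.ofReal_le_ofReal
        (min_le_min le_rfl (Nat.cast_le.mpr hmn))
  rw [hrepr]
  refine AEMeasurable.iSup fun n => AEMeasurable.ennreal_ofReal ?_
  exact ((hμw _ (htrunc n) ⟨n, hb n⟩).mono Set.Ioi_subset_Ici_self).aemeasurable
    measurableSet_Ioi

/-- A lower bound for the weighted occupation integral of a gauge `F` of one coordinate whose
free motion is `z ↦ exp (l * t) * z`, uniform in the rate `l` away from zero. -/
lemma coordinate_le_occupation {H : Type*} [TopologicalSpace H]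
    [MeasurableSpace H] [BorelSpace H] (μ : ℝ → Measure H) [∀ t, IsProbabilityMeasure (μ t)]
    (hμw : ∀ f : H → ℝ, Continuous f → (∃ C, ∀ x, |f x| ≤ C) →
      ContinuousOn (fun t => ∫ y, f y ∂ μ t) (Set.Ici (0 : ℝ)))
    (F : ℝ → ℝ) (hF : Continuous F) (hF0 : ∀ z, 0 ≤ F z) (k : ℝ) (hk : 0 ≤ k)
    (hFk : ∀ z u, Real.exp (-1) * |z| ≤ |u| → F z ≤ k * F u)
    (π : H → ℝ) (hπ : Continuous π) (q l m z : ℝ) (hm : 0 < m) (hl : m ≤ |l|) :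
    ENNReal.ofReal (|l|⁻¹ * F z) ≤ ENNReal.ofReal (k * k * Real.exp (|q| / m)) *
      ((∫⁻ t in Set.Ioi (0 : ℝ), ENNReal.ofReal (Real.exp (-(q * t))) *
          ∫⁻ y, ENNReal.ofReal (F (Real.exp (l * t) * z + π y)) ∂ μ t) +
        ∫⁻ t in Set.Ioi (0 : ℝ), ENNReal.ofReal (Real.exp (-(q * t))) *
          ∫⁻ y, ENNReal.ofReal (F (π y)) ∂ μ t) := by
  have hl0 : 0 < |l| := hm.trans_le hl
  have hFscale : ∀ s z, Real.exp (-1) ≤ s → F z ≤ k * F (s * z) := fun s z hs => by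
    refine hFk z _ ?_
    rw [abs_mul]
    gcongr
    exact hs.trans (le_abs_self s)
  have hFadd : ∀ z w, F z ≤ k * (F (z + w) + F w) := fun z w => by
    have h2 : Real.exp (-1) ≤ 1 / 2 := by
      rw [Real.exp_neg, one_div]
      exact inv_anti₀ two_pos (by linarith [Real.add_one_le_exp (1 : ℝ)])
    have h3 : Real.exp (-1) * |z| ≤ 1 / 2 * |z| := by gcongr
    have h4 : |z| ≤ |z + w| + |w| := by
      simpa using abs_sub (z + w) w
    rcases le_total (1 / 2 * |z|) |w| with h | h
    · nlinarith [hFk z w (h3.trans h), mul_nonneg hk (hF0 (z + w))]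
    · nlinarith [hFk z (z + w) (by linarith), mul_nonneg hk (hF0 w)]
  have hmeas := aemeasurable_lintegral_of_weakly_continuous μ hμw (fun y => F (π y))
    (hF.comp hπ) (fun y => hF0 _)
  have hexp : AEMeasurable (fun t : ℝ => ENNReal.ofReal (Real.exp (-(q * t))))
      (volume.restrict (Set.Ioi (0 : ℝ))) := by fun_prop
  rw [← lintegral_add_right' (μ := volume.restrict (Set.Ioi (0 : ℝ)))
    (g := fun t => ENNReal.ofReal (Real.exp (-(q * t))) *
      ∫⁻ y, ENNReal.ofReal (F (π y)) ∂ μ t) _ (hexp.mul hmeas)]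
  set G : ℝ → ℝ≥0∞ := fun t => ENNReal.ofReal (Real.exp (-(q * t))) *
          ∫⁻ y, ENNReal.ofReal (F (Real.exp (l * t) * z + π y)) ∂ μ t +
        ENNReal.ofReal (Real.exp (-(q * t))) * ∫⁻ y, ENNReal.ofReal (F (π y)) ∂ μ t with hG
  rw [← lintegral_const_mul' _ _ ENNReal.ofReal_ne_top]
  have hpt : ∀ t ∈ Set.Ioc (0 : ℝ) |l|⁻¹,
      ENNReal.ofReal (F z) ≤ ENNReal.ofReal (k * k * Real.exp (|q| / m)) * G t := by
    intro t ht
    have hlt : |l * t| ≤ 1 := by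
      rw [abs_mul, abs_of_pos ht.1]
      calc |l| * t ≤ |l| * |l|⁻¹ := by gcongr; exact ht.2
        _ = 1 := mul_inv_cancel₀ hl0.ne'
    have htm : |q| * t ≤ |q| / m := by
      rw [div_eq_mul_inv]
      gcongr
      exact ht.2.trans (by gcongr)
    have hq1 : 1 ≤ Real.exp (|q| / m) * Real.exp (-(q * t)) := by
      rw [← Real.exp_add]
      refine Real.one_le_exp ?_
      nlinarith [le_abs_self q, ht.1]
    have hFz : ∀ y, F z ≤ k * k * (F (Real.exp (l * t) * z + π y) + F (π y)) := fun y => by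
      have h1 := hFscale (Real.exp (l * t)) z (Real.exp_le_exp.mpr (abs_le.mp hlt).1)
      have h2 := hFadd (Real.exp (l * t) * z) (π y)
      nlinarith
    have hint : ENNReal.ofReal (F z) ≤ ENNReal.ofReal (k * k) *
        (∫⁻ y, ENNReal.ofReal (F (Real.exp (l * t) * z + π y)) ∂ μ t +
          ∫⁻ y, ENNReal.ofReal (F (π y)) ∂ μ t) := by
      rw [← lintegral_add_right (g := fun y => ENNReal.ofReal (F (π y))) _
          (hF.comp hπ).measurable.ennreal_ofReal,
        ← lintegral_const_mul' _ _ ENNReal.ofReal_ne_top]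
      calc ENNReal.ofReal (F z) = ∫⁻ _, ENNReal.ofReal (F z) ∂ μ t := by simp
        _ ≤ _ := lintegral_mono fun y => by
          rw [← ENNReal.ofReal_add (hF0 _) (hF0 _), ← ENNReal.ofReal_mul (by positivity)]
          exact ENNReal.ofReal_le_ofReal (hFz y)
    rw [hG]
    simp only
    rw [← mul_add, ENNReal.ofReal_mul (by positivity)]
    calc ENNReal.ofReal (F z) ≤ _ := hint
      _ = ENNReal.ofReal (k * k) * (1 * (∫⁻ y, ENNReal.ofReal (F (Real.exp (l * t) * z + π y)) ∂ μ t +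
          ∫⁻ y, ENNReal.ofReal (F (π y)) ∂ μ t)) := by rw [one_mul]
      _ ≤ ENNReal.ofReal (k * k) * ((ENNReal.ofReal (Real.exp (|q| / m)) *
          ENNReal.ofReal (Real.exp (-(q * t)))) *
          (∫⁻ y, ENNReal.ofReal (F (Real.exp (l * t) * z + π y)) ∂ μ t +
          ∫⁻ y, ENNReal.ofReal (F (π y)) ∂ μ t)) := by
        gcongr
        rw [← ENNReal.ofReal_mul (by positivity), ENNReal.one_le_ofReal]
        exact hq1
      _ = _ := by ring
  calc ENNReal.ofReal (|l|⁻¹ * F z)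
      = ∫⁻ _ in Set.Ioc (0 : ℝ) |l|⁻¹, ENNReal.ofReal (F z) := by
        rw [setLIntegral_const, Real.volume_Ioc, sub_zero, mul_comm,
          ENNReal.ofReal_mul (hF0 z)]
    _ ≤ ∫⁻ t in Set.Ioc (0 : ℝ) |l|⁻¹, ENNReal.ofReal (k * k * Real.exp (|q| / m)) * G t :=
        setLIntegral_mono' measurableSet_Ioc hpt
    _ ≤ _ := lintegral_mono_set Set.Ioc_subset_Ioi_self

/-- Abel means at large parameter of a function which is close to `c` near zero. -/
lemma abs_mul_laplace_sub_le (φ : ℝ → ℝ) (c B ε D α : ℝ) (hα : 0 < α)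
    (hφ : AEStronglyMeasurable φ (volume.restrict (Set.Ioi (0 : ℝ))))
    (hφB : ∀ t, |φ t| ≤ B) (h : ∀ t, 0 < t → |φ t - c| ≤ ε + D * t) :
    |α * (∫ t in Set.Ioi (0 : ℝ), Real.exp (-(α * t)) * φ t) - c| ≤ ε + D / α := by
  have hexp : IntegrableOn (fun t : ℝ => Real.exp (-(α * t))) (Set.Ioi 0) := by
    simpa [neg_mul] using exp_neg_integrableOn_Ioi 0 hα
  have hexp1 : ∫ t in Set.Ioi (0 : ℝ), Real.exp (-(α * t)) = 1 / α := by
    have := Real.integral_rpow_mul_exp_neg_mul_Ioi (a := 1) (r := α) one_pos hα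
    simpa using this
  have hexp2 : ∫ t in Set.Ioi (0 : ℝ), t * Real.exp (-(α * t)) = 1 / α ^ 2 := by
    have := Real.integral_rpow_mul_exp_neg_mul_Ioi (a := 2) (r := α) two_pos hα
    have h2 : (2 : ℝ) - 1 = 1 := by norm_num
    simpa [h2, Real.rpow_one, Real.Gamma_two] using this
  have hexp2i : IntegrableOn (fun t : ℝ => t * Real.exp (-(α * t))) (Set.Ioi 0) := by
    refine not_imp_comm.mp integral_undef ?_
    rw [hexp2]
    positivity
  have hi : IntegrableOn (fun t : ℝ => Real.exp (-(α * t)) * φ t) (Set.Ioi 0) :=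
    Integrable.mul_bdd (c := B) hexp hφ (Eventually.of_forall hφB)
  have hkey : α * (∫ t in Set.Ioi (0 : ℝ), Real.exp (-(α * t)) * φ t) - c
      = ∫ t in Set.Ioi (0 : ℝ), α * (Real.exp (-(α * t)) * φ t - c * Real.exp (-(α * t))) := by
    rw [integral_const_mul, integral_sub hi (hexp.const_mul c), integral_const_mul, hexp1]
    field_simp
  rw [hkey]
  have hbound : ‖∫ t in Set.Ioi (0 : ℝ),
      α * (Real.exp (-(α * t)) * φ t - c * Real.exp (-(α * t)))‖ ≤
      ∫ t in Set.Ioi (0 : ℝ), (α * ε * Real.exp (-(α * t)) +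
        α * D * (t * Real.exp (-(α * t)))) := by
    refine norm_integral_le_of_norm_le ((hexp.const_mul _).add (hexp2i.const_mul _)) ?_
    refine (ae_restrict_iff' measurableSet_Ioi).mpr (Eventually.of_forall fun t ht => ?_)
    have : α * (Real.exp (-(α * t)) * φ t - c * Real.exp (-(α * t)))
        = α * Real.exp (-(α * t)) * (φ t - c) := by ring
    rw [this, norm_mul, Real.norm_of_nonneg (by positivity), Real.norm_eq_abs]
    calc α * Real.exp (-(α * t)) * |φ t - c|
        ≤ α * Real.exp (-(α * t)) * (ε + D * t) := by gcongr; exact h t ht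
      _ = _ := by ring
  rw [Real.norm_eq_abs] at hbound
  refine hbound.trans (le_of_eq ?_)
  rw [integral_add (hexp.const_mul _) (hexp2i.const_mul _), integral_const_mul,
    integral_const_mul, hexp1, hexp2]
  field_simp

/-- A diagonal semigroup moves the points of `S` uniformly little at small times, as soon as
the coordinates are bounded on `S` and satisfy a uniform weighted `p`-summability there. -/
lemma exists_forall_norm_semigroup_sub_le
    {H : Type*} [NormedAddCommGroup H] [InnerProductSpace ℝ H]
    (b : HilbertBasis ℕ ℝ H) (lam : ℕ → ℝ) (hlamne : ∀ i, lam i ≠ 0) (hlamanti : Antitone lam)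
    (hlamtop : Tendsto lam atTop atBot) (T : ℝ → H →L[ℝ] H)
    (hTeig : ∀ t : ℝ, 0 ≤ t → ∀ (x : H) (i : ℕ),
      ⟪T t x, b i⟫ = Real.exp (lam i * t) * ⟪x, b i⟫)
    (p a : ℝ) (hp : 2 < p) (ha : 0 < a)
    (hsum : Summable fun i => |lam i| ^ (-(2 * a / (p - 2))))
    (S : Set H) (K : ℝ) (hK : 0 ≤ K)
    (hSK : ∀ x ∈ S, ∑' i, ENNReal.ofReal (|lam i| ^ a * min (|⟪x, b i⟫| ^ p) 1)
      ≤ ENNReal.ofReal K)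
    (M : ℕ → ℝ) (hSM : ∀ x ∈ S, ∀ i, |⟪x, b i⟫| ≤ M i) (ε : ℝ) (hε : 0 < ε) :
    ∃ t₀ : ℝ, 0 < t₀ ∧ ∀ t, 0 ≤ t → t ≤ t₀ → ∀ x ∈ S, ‖T t x - x‖ ≤ ε := by
  have hw0 : ∀ x i, 0 ≤ |lam i| ^ a * min (|⟪x, b i⟫| ^ p) 1 := fun x i => by positivity
  have hwsum : ∀ x ∈ S, Summable fun i => |lam i| ^ a * min (|⟪x, b i⟫| ^ p) 1 := by
    intro x hx
    have h := ENNReal.summable_toReal (ne_top_of_le_ne_top ENNReal.ofReal_ne_top (hSK x hx))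
    simpa only [ENNReal.toReal_ofReal (hw0 x _)] using h
  have hwK : ∀ x ∈ S, ∑' i, |lam i| ^ a * min (|⟪x, b i⟫| ^ p) 1 ≤ K := by
    intro x hx
    have h := hSK x hx
    rwa [← ENNReal.ofReal_tsum_of_nonneg (hw0 x) (hwsum x hx),
      ENNReal.ofReal_le_ofReal_iff hK] at h
  have hlamabs : Tendsto (fun i => |lam i| ^ a) atTop atTop :=
    (tendsto_rpow_atTop ha).comp (tendsto_abs_atBot_atTop.comp hlamtop)
  obtain ⟨N, hN⟩ := (hlamabs.eventually_gt_atTop K).exists_forall_of_atTop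
  set E : ℝ := (1 + Real.exp |lam 0|) ^ 2 with hE
  have hEpos : 0 < E := by positivity
  set δ : ℝ := ε ^ 2 / (2 * (E * (K + 1))) with hδ
  have hδpos : 0 < δ := by positivity
  have hδle : δ * E * K ≤ ε ^ 2 / 2 := by
    have h1 : δ * E * (K + 1) = ε ^ 2 / 2 := by rw [hδ]; field_simp
    nlinarith [mul_pos hδpos hEpos]
  have hp2 : 0 < p - 2 := by linarith
  set B : ℕ → ℝ := fun i => if i < N then M i ^ 2 else
    δ ^ (-(2 / (p - 2))) * |lam i| ^ (-(2 * a / (p - 2))) with hB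
  have hBsum : Summable B := by
    rw [← summable_nat_add_iff N]
    have h := (summable_nat_add_iff N).mpr (hsum.mul_left (δ ^ (-(2 / (p - 2)))))
    refine h.congr fun i => ?_
    simp [hB]
  have hB0 : ∀ i, 0 ≤ B i := fun i => by
    simp only [hB]
    split_ifs <;> positivity
  have hcoord : ∀ x ∈ S, ∀ i,
      |⟪x, b i⟫| ^ 2 ≤ δ * (|lam i| ^ a * min (|⟪x, b i⟫| ^ p) 1) + B i := by
    intro x hx i
    have hlp : 0 < |lam i| := abs_pos.mpr (hlamne i)
    rcases lt_or_ge i N with hi | hi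
    · simp only [hB, if_pos hi]
      have h1 : |⟪x, b i⟫| ^ 2 ≤ M i ^ 2 := by gcongr; exact hSM x hx i
      have h2 := mul_nonneg hδpos.le (hw0 x i)
      linarith
    · simp only [hB, if_neg hi.not_gt]
      set z := |⟪x, b i⟫| with hz
      have hz0 : 0 ≤ z := abs_nonneg _
      have hmin : min (z ^ p) 1 = z ^ p := by
        by_contra hne
        have h1 : min (z ^ p) 1 = 1 := (min_choice _ _).resolve_left hne
        have h2 := ((hwsum x hx).le_tsum i fun j _ => hw0 x j).trans (hwK x hx)
        rw [← hz, h1, mul_one] at h2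
        exact (hN i hi).not_ge h2
      rw [hmin]
      rcases hz0.eq_or_lt with hz1 | hz1
      · rw [← hz1]
        simp only [ne_eq, OfNat.ofNat_ne_zero, not_false_eq_true, zero_pow]
        positivity
      have hu : 0 < δ * |lam i| ^ a := by positivity
      have hzp : z ^ p = z ^ (p - 2) * z ^ 2 := by
        rw [← Real.rpow_natCast z 2, ← Real.rpow_add hz1]
        norm_num
      rcases le_total 1 (δ * |lam i| ^ a * z ^ (p - 2)) with hc | hc
      · have h1 : z ^ 2 ≤ δ * (|lam i| ^ a * z ^ p) := by
          rw [hzp]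
          nlinarith [sq_nonneg z]
        have h2 : 0 ≤ δ ^ (-(2 / (p - 2))) * |lam i| ^ (-(2 * a / (p - 2))) := by positivity
        linarith
      · have h1 : z ^ 2 ≤ δ ^ (-(2 / (p - 2))) * |lam i| ^ (-(2 * a / (p - 2))) := by
          have h3 : z ^ (p - 2) ≤ (δ * |lam i| ^ a)⁻¹ := by
            rw [← one_div, le_div_iff₀ hu]
            linarith
          have h4 := Real.rpow_le_rpow (by positivity) h3 (by positivity : 0 ≤ 2 / (p - 2))
          rw [← Real.rpow_mul hz0, mul_div_cancel₀ _ hp2.ne',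
            Real.inv_rpow hu.le, ← Real.rpow_neg hu.le, Real.mul_rpow hδpos.le (by positivity),
            ← Real.rpow_mul hlp.le] at h4
          rw [← Real.rpow_natCast z 2]
          rw [show a * -(2 / (p - 2)) = -(2 * a / (p - 2)) by ring] at h4
          exact_mod_cast h4
        have h2 : 0 ≤ δ * (|lam i| ^ a * z ^ p) := by positivity
        linarith
  have hfac : ∀ t, 0 ≤ t → t ≤ 1 → ∀ i, (Real.exp (lam i * t) - 1) ^ 2 ≤ E := by
    intro t ht0 ht1 i
    have h1 : Real.exp (lam i * t) ≤ Real.exp |lam 0| := by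
      refine Real.exp_le_exp.mpr ?_
      have h2 : lam i ≤ |lam 0| := (hlamanti (Nat.zero_le i)).trans (le_abs_self _)
      nlinarith [abs_nonneg (lam 0)]
    rw [hE]
    refine sq_le_sq' ?_ ?_ <;> linarith [Real.exp_pos (lam i * t), Real.exp_pos |lam 0|]
  have hlim : Tendsto (fun t => ∑' i, (Real.exp (lam i * t) - 1) ^ 2 * B i)
      (𝓝[Set.Icc 0 1] 0) (𝓝 (∑' i, (Real.exp (lam i * 0) - 1) ^ 2 * B i)) := by
    refine tendsto_tsum_of_dominated_convergence (bound := fun i => E * B i)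
      (hBsum.mul_left E) (fun i => ?_) ?_
    · have : Continuous fun t => (Real.exp (lam i * t) - 1) ^ 2 * B i := by fun_prop
      exact this.continuousWithinAt
    · filter_upwards [self_mem_nhdsWithin] with t ht i
      rw [Real.norm_of_nonneg (mul_nonneg (sq_nonneg _) (hB0 i))]
      exact mul_le_mul_of_nonneg_right (hfac t ht.1 ht.2 i) (hB0 i)
  simp only [mul_zero, Real.exp_zero, sub_self, ne_eq, OfNat.ofNat_ne_zero, not_false_eq_true,
    zero_pow, zero_mul, tsum_zero] at hlim
  have hev := hlim.eventually_lt_const (by positivity : (0 : ℝ) < ε ^ 2 / 2)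
  rw [eventually_nhdsWithin_iff, Metric.eventually_nhds_iff] at hev
  obtain ⟨r, hr, hr'⟩ := hev
  refine ⟨min 1 (r / 2), by positivity, fun t ht0 ht1 x hx => ?_⟩
  have ht1' : t ≤ 1 := ht1.trans (min_le_left _ _)
  have htr : t ≤ r / 2 := ht1.trans (min_le_right _ _)
  have hsmall := hr' (y := t) (by rw [Real.dist_0_eq_abs, abs_of_nonneg ht0]; linarith)
    ⟨ht0, ht1'⟩
  have hnorm : HasSum (fun i => ⟪T t x - x, b i⟫ * ⟪b i, T t x - x⟫) (‖T t x - x‖ ^ 2) := by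
    have := b.hasSum_inner_mul_inner (T t x - x) (T t x - x)
    rwa [real_inner_self_eq_norm_sq] at this
  have hBs : Summable fun i => (Real.exp (lam i * t) - 1) ^ 2 * B i :=
    Summable.of_nonneg_of_le (fun i => mul_nonneg (sq_nonneg _) (hB0 i))
      (fun i => mul_le_mul_of_nonneg_right (hfac t ht0 ht1' i) (hB0 i)) (hBsum.mul_left E)
  have hsq : ‖T t x - x‖ ^ 2 ≤ ε ^ 2 := by
    have h1 := hasSum_le (fun i => ?_) hnorm
      (((hwsum x hx).hasSum.mul_left (δ * E)).add hBs.hasSum)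
    · have h2 : δ * E * ∑' i, |lam i| ^ a * min (|⟪x, b i⟫| ^ p) 1 ≤ δ * E * K := by
        gcongr
        exact hwK x hx
      linarith
    · have h3 : ⟪T t x - x, b i⟫ * ⟪b i, T t x - x⟫
          = (Real.exp (lam i * t) - 1) ^ 2 * |⟪x, b i⟫| ^ 2 := by
        rw [real_inner_comm (T t x - x) (b i), inner_sub_left, hTeig t ht0, sq_abs]
        ring
      rw [h3]
      have h4 := mul_le_mul_of_nonneg_left (hcoord x hx i)
        (sq_nonneg (Real.exp (lam i * t) - 1))
      have h5 := mul_le_mul_of_nonneg_right (hfac t ht0 ht1' i)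
        (mul_nonneg hδpos.le (hw0 x i))
      nlinarith
  exact le_of_sq_le_sq hsq hε.le

theorem stmt14
    {H : Type*} [NormedAddCommGroup H] [InnerProductSpace ℝ H] [CompleteSpace H]
    [SecondCountableTopology H] [MeasurableSpace H] [BorelSpace H]
    (b : HilbertBasis ℕ ℝ H)
    (lam : ℕ → ℝ) (hlamne : ∀ i, lam i ≠ 0) (hlamanti : Antitone lam)
    (hlamtop : Tendsto lam atTop atBot)
    (T : ℝ → H →L[ℝ] H)
    (hT0 : T 0 = ContinuousLinearMap.id ℝ H)
    (hTsg : ∀ s t : ℝ, 0 ≤ s → 0 ≤ t → T (t + s) = (T t).comp (T s))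
    (hTcont : ∀ x : H, ContinuousOn (fun t => T t x) (Set.Ici (0 : ℝ)))
    (hTeig : ∀ t : ℝ, 0 ≤ t → ∀ (x : H) (i : ℕ),
      ⟪T t x, b i⟫ = Real.exp (lam i * t) * ⟪x, b i⟫)
    (μ : ℝ → Measure H) [∀ t, IsProbabilityMeasure (μ t)]
    (hμ0 : μ 0 = Measure.dirac 0)
    (hμw : ∀ f : H → ℝ, Continuous f → (∃ C, ∀ x, |f x| ≤ C) →
      ContinuousOn (fun t => ∫ y, f y ∂ μ t) (Set.Ici (0 : ℝ)))
    (hμconv : ∀ s t : ℝ, 0 ≤ s → 0 ≤ t →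
      μ (t + s) = Measure.map (fun yz : H × H => yz.1 + yz.2)
        (((μ t).map (T s)).prod (μ s)))
    (p a q γ : ℝ) (hp : 2 < p) (ha : 0 < a) (hq : p * lam 0 < q)
    (hγ0 : 0 < γ) (hγ1 : γ ≤ 1)
    (c1 : ℝ≥0∞)
    (hc1def : c1 = ∑' i : ℕ, ENNReal.ofReal (|lam i| ^ (1 + a)) *
      ∫⁻ t in Set.Ioi (0 : ℝ), ENNReal.ofReal (Real.exp (-(q * t))) *
        ∫⁻ y, ENNReal.ofReal (min (|⟪y, b i⟫| ^ p) 1) ∂ μ t)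
    (hc1 : c1 ≠ ⊤)
    (hsum1 : ∀ t : ℝ, 0 < t → Summable fun i => |lam i| ^ a * Real.exp (p * lam i * t))
    (hsum2 : Summable fun i => |lam i| ^ (-(2 * a / (p - 2))))
    (hmom : ∀ i : ℕ, (∫⁻ t in Set.Ioi (0 : ℝ), ENNReal.ofReal (Real.exp (-(q * t))) *
        ∫⁻ y, ENNReal.ofReal (|⟪y, b i⟫| ^ γ) ∂ μ t) ≠ ⊤)
    (g : ℕ → ℝ) (hg0 : ∀ i, 0 < g i) (hg1 : ∀ i, g i ≤ 1) (hganti : Antitone g)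
    (hgsum : Summable fun i => g i ^ (2 / (2 - γ)))
    (c2 : ℝ≥0∞)
    (hc2def : c2 = ∑' i : ℕ, ENNReal.ofReal (g i) *
      ∫⁻ t in Set.Ioi (0 : ℝ), ENNReal.ofReal (Real.exp (-(q * t))) *
        ∫⁻ y, ENNReal.ofReal (|⟪y, b i⟫| ^ γ) ∂ μ t)
    (hc2 : c2 ≠ ⊤)
    (v : H → ℝ≥0∞)
    (hvdef : ∀ x : H, v x
      = (∑' i : ℕ, ENNReal.ofReal (|lam i| ^ (1 + a) * min (|⟪x, b i⟫| ^ p) 1))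
        + ∑' i : ℕ, ENNReal.ofReal (g i * |⟪x, b i⟫| ^ γ))
    (V : H → ℝ≥0∞)
    (hVdef : ∀ x : H, V x = ∫⁻ t in Set.Ioi (0 : ℝ),
      ENNReal.ofReal (Real.exp (-(q * t))) * ∫⁻ y, v (T t x + y) ∂ μ t)
    (H0 : Set H)
    (hH0 : H0 = {x : H | Summable fun i => |lam i| ^ a * |⟪x, b i⟫| ^ p})
    (f : H → ℝ) (C : ℝ) (hfb : ∀ x, |f x| ≤ C)
    (L : ℝ) (hfLip : ∀ x x' : H, |f x - f x'| ≤ L * ‖x - x'‖)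
    (Uf : ℝ → H → ℝ)
    (hUf : ∀ (α : ℝ) (x : H), Uf α x
      = ∫ t in Set.Ioi (0 : ℝ), Real.exp (-(α * t)) * ∫ y, f (T t x + y) ∂ μ t) :
    ∀ R : ℝ, 0 < R → ∀ ε : ℝ, 0 < ε → ∃ α₀ : ℝ, ∀ α : ℝ, α₀ ≤ α → ∀ x : H,
      V x ≤ ENNReal.ofReal R → |α * Uf α x - f x| ≤ ε := by
  classical
  intro R hR ε hε
  set F₁ : ℝ → ℝ := fun z => min (|z| ^ p) 1 with hF₁
  set F₂ : ℝ → ℝ := fun z => |z| ^ γ with hF₂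
  have hp0 : 0 < p := by linarith
  have hF₁c : Continuous F₁ :=
    (continuous_abs.rpow_const fun _ => Or.inr hp0.le).min continuous_const
  have hF₂c : Continuous F₂ := continuous_abs.rpow_const fun _ => Or.inr hγ0.le
  have hF₁0 : ∀ z, 0 ≤ F₁ z := fun z => by positivity
  have hF₂0 : ∀ z, 0 ≤ F₂ z := fun z => by positivity
  have hrpow : ∀ r : ℝ, 0 < r → ∀ z u : ℝ, Real.exp (-1) * |z| ≤ |u| →
      |z| ^ r ≤ Real.exp r * |u| ^ r := fun r hr z u h => by
    have h1 : |z| ≤ Real.exp 1 * |u| := by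
      calc |z| = Real.exp 1 * (Real.exp (-1) * |z|) := by
            rw [← mul_assoc, ← Real.exp_add]; simp
        _ ≤ _ := by gcongr
    calc |z| ^ r ≤ (Real.exp 1 * |u|) ^ r := by gcongr
      _ = Real.exp r * |u| ^ r := by
        rw [Real.mul_rpow (Real.exp_nonneg 1) (abs_nonneg u), Real.exp_one_rpow]
  have hF₁k : ∀ z u, Real.exp (-1) * |z| ≤ |u| → F₁ z ≤ Real.exp p * F₁ u := fun z u h => by
    simp only [hF₁]
    rw [mul_min_of_nonneg _ _ (Real.exp_nonneg p), mul_one]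
    exact min_le_min (hrpow p hp0 z u h) (Real.one_le_exp hp0.le)
  obtain ⟨m, hm, hlm⟩ : ∃ m : ℝ, 0 < m ∧ ∀ i, m ≤ |lam i| := by
    have h1 : ∀ᶠ i in atTop, 1 ≤ |lam i| :=
      (tendsto_abs_atBot_atTop.comp hlamtop).eventually_ge_atTop 1
    obtain ⟨N, hN⟩ := h1.exists_forall_of_atTop
    obtain ⟨j, -, hj⟩ := Finset.exists_min_image (Finset.range (N + 1)) (fun i => |lam i|)
      ⟨0, by simp⟩
    refine ⟨min 1 |lam j|, lt_min one_pos (abs_pos.mpr (hlamne j)), fun i => ?_⟩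
    rcases le_total N i with hi | hi
    · exact (min_le_left _ _).trans (hN i hi)
    · exact (min_le_right _ _).trans (hj i (Finset.mem_range.mpr (by omega)))
  have hπ : ∀ i, Continuous fun y : H => ⟪y, b i⟫ := fun i => by fun_prop
  let w : ℝ → ℝ≥0∞ := fun t => ENNReal.ofReal (Real.exp (-(q * t)))
  let P : (ℝ → ℝ) → H → ℕ → ℝ≥0∞ := fun F x i => ∫⁻ t in Set.Ioi (0 : ℝ), w t *
    ∫⁻ y, ENNReal.ofReal (F (Real.exp (lam i * t) * ⟪x, b i⟫ + ⟪y, b i⟫)) ∂ μ t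
  let Q : (ℝ → ℝ) → ℕ → ℝ≥0∞ := fun F i => ∫⁻ t in Set.Ioi (0 : ℝ), w t *
    ∫⁻ y, ENNReal.ofReal (F ⟪y, b i⟫) ∂ μ t
  let K₁ : ℝ≥0∞ := ENNReal.ofReal (Real.exp p * Real.exp p * Real.exp (|q| / m))
  let K₂ : ℝ≥0∞ := ENNReal.ofReal (Real.exp γ * Real.exp γ * Real.exp (|q| / m))
  have hocc₁ : ∀ x i, ENNReal.ofReal (|lam i|⁻¹ * F₁ ⟪x, b i⟫) ≤ K₁ * (P F₁ x i + Q F₁ i) :=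
    fun x i => coordinate_le_occupation μ hμw F₁ hF₁c hF₁0 _ (Real.exp_nonneg p) hF₁k _ (hπ i)
      q (lam i) m ⟪x, b i⟫ hm (hlm i)
  have hocc₂ : ∀ x i, ENNReal.ofReal (|lam i|⁻¹ * F₂ ⟪x, b i⟫) ≤ K₂ * (P F₂ x i + Q F₂ i) :=
    fun x i => coordinate_le_occupation μ hμw F₂ hF₂c hF₂0 _ (Real.exp_nonneg γ) (hrpow γ hγ0)
      _ (hπ i) q (lam i) m ⟪x, b i⟫ hm (hlm i)
  have hPsum : ∀ (F : ℝ → ℝ) (d : ℕ → ℝ), (∀ i, 0 ≤ d i) →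
      (∀ y : H, ∑' i, ENNReal.ofReal (d i * F ⟪y, b i⟫) ≤ v y) →
      ∀ x, ∑' i, ENNReal.ofReal (d i) * P F x i ≤ V x := by
    intro F d hd hdv x
    rw [hVdef]
    simp only [P]
    simp_rw [← lintegral_const_mul' _ _ ENNReal.ofReal_ne_top]
    refine (tsum_lintegral_le_lintegral_tsum _ _).trans
      (setLIntegral_mono' measurableSet_Ioi fun t ht => ?_)
    have ht0 : (0 : ℝ) ≤ t := le_of_lt ht
    simp_rw [mul_left_comm (ENNReal.ofReal (d _)) (w t)]
    rw [ENNReal.tsum_mul_left, lintegral_const_mul' _ _ ENNReal.ofReal_ne_top]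
    refine mul_le_mul' le_rfl ?_
    simp_rw [← lintegral_const_mul' _ _ ENNReal.ofReal_ne_top]
    refine (tsum_lintegral_le_lintegral_tsum _ _).trans (lintegral_mono fun y => ?_)
    refine le_trans (le_of_eq (tsum_congr fun i => ?_)) (hdv (T t x + y))
    rw [← ENNReal.ofReal_mul (hd i), inner_add_left, hTeig t ht0]
  have hV₁ : ∀ x, ∑' i, ENNReal.ofReal (|lam i| ^ (1 + a)) * P F₁ x i ≤ V x :=
    hPsum F₁ _ (fun i => by positivity) fun y => by
      rw [hvdef]
      exact le_self_add
  have hV₂ : ∀ x, ∑' i, ENNReal.ofReal (g i) * P F₂ x i ≤ V x :=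
    hPsum F₂ _ (fun i => (hg0 i).le) fun y => by
      rw [hvdef]
      exact le_add_self
  set S : Set H := {x | V x ≤ ENNReal.ofReal R} with hS
  have hK₁top : K₁ * (ENNReal.ofReal R + c1) ≠ ⊤ :=
    ENNReal.mul_ne_top ENNReal.ofReal_ne_top (ENNReal.add_ne_top.mpr ⟨ENNReal.ofReal_ne_top, hc1⟩)
  have hSK : ∀ x ∈ S, ∑' i, ENNReal.ofReal (|lam i| ^ a * min (|⟪x, b i⟫| ^ p) 1)
      ≤ ENNReal.ofReal (K₁ * (ENNReal.ofReal R + c1)).toReal := by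
    intro x hx
    rw [ENNReal.ofReal_toReal hK₁top]
    calc ∑' i, ENNReal.ofReal (|lam i| ^ a * min (|⟪x, b i⟫| ^ p) 1)
        ≤ ∑' i, K₁ * (ENNReal.ofReal (|lam i| ^ (1 + a)) * P F₁ x i
            + ENNReal.ofReal (|lam i| ^ (1 + a)) * Q F₁ i) := by
          refine ENNReal.tsum_le_tsum fun i => ?_
          have hl : 0 < |lam i| := abs_pos.mpr (hlamne i)
          calc ENNReal.ofReal (|lam i| ^ a * min (|⟪x, b i⟫| ^ p) 1)
              = ENNReal.ofReal (|lam i| ^ (1 + a)) *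
                  ENNReal.ofReal (|lam i|⁻¹ * F₁ ⟪x, b i⟫) := by
                rw [← ENNReal.ofReal_mul (by positivity), Real.rpow_add hl, Real.rpow_one]
                congr 1
                field_simp
                rfl
            _ ≤ ENNReal.ofReal (|lam i| ^ (1 + a)) * (K₁ * (P F₁ x i + Q F₁ i)) := by
                gcongr
                exact hocc₁ x i
            _ = _ := by ring
      _ = K₁ * (∑' i, ENNReal.ofReal (|lam i| ^ (1 + a)) * P F₁ x i + c1) := by
          rw [ENNReal.tsum_mul_left, ENNReal.tsum_add, hc1def]
      _ ≤ _ := by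
          gcongr
          exact (hV₁ x).trans hx
  have hcoordM : ∀ i, ∃ M : ℝ, ∀ x ∈ S, |⟪x, b i⟫| ≤ M := by
    intro i
    have hl : 0 < |lam i| := abs_pos.mpr (hlamne i)
    set A : ℝ≥0∞ := K₂ * (ENNReal.ofReal R + c2) with hA
    have hAtop : A ≠ ⊤ := ENNReal.mul_ne_top ENNReal.ofReal_ne_top
      (ENNReal.add_ne_top.mpr ⟨ENNReal.ofReal_ne_top, hc2⟩)
    refine ⟨(|lam i| / g i * A.toReal) ^ γ⁻¹, fun x hx => ?_⟩
    have h1 : ENNReal.ofReal (g i * (|lam i|⁻¹ * F₂ ⟪x, b i⟫)) ≤ A := by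
      rw [ENNReal.ofReal_mul (hg0 i).le]
      calc ENNReal.ofReal (g i) * ENNReal.ofReal (|lam i|⁻¹ * F₂ ⟪x, b i⟫)
          ≤ ENNReal.ofReal (g i) * (K₂ * (P F₂ x i + Q F₂ i)) := by
            gcongr
            exact hocc₂ x i
        _ = K₂ * (ENNReal.ofReal (g i) * P F₂ x i + ENNReal.ofReal (g i) * Q F₂ i) := by ring
        _ ≤ A := by
            rw [hA]
            gcongr
            · exact (ENNReal.le_tsum i).trans ((hV₂ x).trans hx)
            · rw [hc2def]
              exact ENNReal.le_tsum (f := fun i => ENNReal.ofReal (g i) * Q F₂ i) i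
    have h2 := (ENNReal.ofReal_le_iff_le_toReal hAtop).mp h1
    have h3 : |⟪x, b i⟫| ^ γ ≤ |lam i| / g i * A.toReal := by
      have hgi := hg0 i
      calc |⟪x, b i⟫| ^ γ = |lam i| / g i * (g i * (|lam i|⁻¹ * F₂ ⟪x, b i⟫)) := by
            field_simp
            rfl
        _ ≤ _ := by gcongr
    exact (Real.le_rpow_inv_iff_of_pos (abs_nonneg _) ((by positivity : (0:ℝ) ≤ _).trans h3)
      hγ0).mpr h3
  choose M hM using hcoordM
  have hC : 0 ≤ C := (abs_nonneg _).trans (hfb 0)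
  set L' : ℝ := max L 0 with hL'
  have hL'0 : 0 ≤ L' := le_max_right _ _
  have hfLip' : ∀ x x' : H, |f x - f x'| ≤ L' * ‖x - x'‖ := fun x x' =>
    (hfLip x x').trans (by gcongr; exact le_max_left _ _)
  have hfcont : Continuous f := by
    refine (LipschitzWith.of_dist_le_mul (K := L'.toNNReal) fun x x' => ?_).continuous
    rw [Real.dist_eq, dist_eq_norm, Real.coe_toNNReal _ hL'0]
    exact hfLip' x x'
  have hint : ∀ t x, Integrable (fun y => f (x + y)) (μ t) := fun t x =>
    Integrable.of_bound (by fun_prop) C (Eventually.of_forall fun y => hfb _)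
  let ψ : H → ℝ := fun y => min (2 * C) (L' * ‖y‖)
  have hψc : Continuous ψ := by fun_prop
  have hψ0 : ∀ y, 0 ≤ ψ y := fun y => by positivity
  have hψb : ∀ y, |ψ y| ≤ 2 * C := fun y => by
    rw [abs_of_nonneg (hψ0 y)]
    exact min_le_left _ _
  obtain ⟨t₁, ht₁, hsmall₁⟩ : ∃ t₁ : ℝ, 0 < t₁ ∧ ∀ t, 0 ≤ t → t ≤ t₁ →
      ∫ y, ψ y ∂ μ t ≤ ε / 4 := by
    have h1 : Tendsto (fun t => ∫ y, ψ y ∂ μ t) (𝓝[Set.Ici 0] 0) (𝓝 (∫ y, ψ y ∂ μ 0)) :=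
      hμw ψ hψc ⟨_, hψb⟩ 0 Set.self_mem_Ici
    have h2 : ∫ y, ψ y ∂ μ 0 = 0 := by
      rw [hμ0, integral_dirac]
      simp [ψ, hC]
    rw [h2] at h1
    have hev := h1.eventually_lt_const (by positivity : (0 : ℝ) < ε / 4)
    rw [eventually_nhdsWithin_iff, Metric.eventually_nhds_iff] at hev
    obtain ⟨r, hr, hr'⟩ := hev
    refine ⟨r / 2, by positivity, fun t ht0 ht1 => (hr' ?_ ht0).le⟩
    rw [Real.dist_0_eq_abs, abs_of_nonneg ht0]
    linarith
  obtain ⟨t₂, ht₂, hsmall₂⟩ := exists_forall_norm_semigroup_sub_le b lam hlamne hlamanti hlamtop T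
    hTeig p a hp ha hsum2 S _ ENNReal.toReal_nonneg hSK M (fun x hx i => hM i x hx)
    (ε / (4 * (L' + 1))) (by positivity)
  set t₀ : ℝ := min t₁ t₂ with ht₀
  have ht₀pos : 0 < t₀ := lt_min ht₁ ht₂
  have hfC : ∀ t x, |∫ y, f (x + y) ∂ μ t| ≤ C := fun t x => by
    simpa using norm_integral_le_of_norm_le_const (μ := μ t) (f := fun y => f (x + y)) (C := C)
      (Eventually.of_forall fun y => hfb _)
  have hclose : ∀ t, 0 ≤ t → ∀ x x', |∫ y, f (x + y) ∂ μ t - ∫ y, f (x' + y) ∂ μ t|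
      ≤ L' * ‖x - x'‖ := fun t _ x x' => by
    rw [← integral_sub (hint t x) (hint t x')]
    simpa using norm_integral_le_of_norm_le_const (μ := μ t)
      (f := fun y => f (x + y) - f (x' + y)) (C := L' * ‖x - x'‖)
      (Eventually.of_forall fun y => by simpa using hfLip' (x + y) (x' + y))
  have hcontt : ∀ x, ContinuousOn (fun t => ∫ y, f (T t x + y) ∂ μ t) (Set.Ici (0 : ℝ)) := by
    intro x s hs
    have h1 : Tendsto (fun t => ∫ y, f (T s x + y) ∂ μ t) (𝓝[Set.Ici 0] s)
        (𝓝 (∫ y, f (T s x + y) ∂ μ s)) :=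
      hμw (fun y => f (T s x + y)) (by fun_prop) ⟨C, fun y => hfb _⟩ s hs
    have h2 : Tendsto (fun t => L' * ‖T t x - T s x‖) (𝓝[Set.Ici 0] s) (𝓝 0) := by
      have h3 : Tendsto (fun t => T t x) (𝓝[Set.Ici 0] s) (𝓝 (T s x)) := hTcont x s hs
      simpa using ((h3.sub_const (T s x)).norm).const_mul L'
    have h4 : Tendsto (fun t => ∫ y, f (T t x + y) ∂ μ t - ∫ y, f (T s x + y) ∂ μ t)
        (𝓝[Set.Ici 0] s) (𝓝 0) :=
      squeeze_zero_norm' (by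
        filter_upwards [self_mem_nhdsWithin] with t ht
        exact hclose t ht _ _) h2
    have h5 := h4.add h1
    simpa [ContinuousWithinAt] using h5
  refine ⟨max 1 (4 * C / (t₀ * ε)), fun α hα x hx => ?_⟩
  have hα1 : 1 ≤ α := (le_max_left _ _).trans hα
  have hα0 : 0 < α := by linarith
  have hα2 : 4 * C / (t₀ * ε) ≤ α := (le_max_right _ _).trans hα
  rw [hUf]
  refine (abs_mul_laplace_sub_le _ (f x) C (ε / 2) (2 * C / t₀) α hα0
    (((hcontt x).mono Set.Ioi_subset_Ici_self).aestronglyMeasurable measurableSet_Ioi)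
    (fun t => hfC t _) fun t ht => ?_).trans ?_
  · rcases le_total t t₀ with htt | htt
    · have h1 : |∫ y, f (T t x + y) ∂ μ t - ∫ y, f (x + y) ∂ μ t| ≤ ε / 4 := by
        refine (hclose t ht.le _ _).trans ?_
        calc L' * ‖T t x - x‖ ≤ L' * (ε / (4 * (L' + 1))) := by
              gcongr
              exact hsmall₂ t ht.le (htt.trans (min_le_right _ _)) x hx
          _ ≤ (L' + 1) * (ε / (4 * (L' + 1))) := by gcongr; linarith
          _ = ε / 4 := by field_simp
      have h2 : |∫ y, f (x + y) ∂ μ t - f x| ≤ ε / 4 := by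
        have h3 : ∫ y, f (x + y) ∂ μ t - f x = ∫ y, (f (x + y) - f x) ∂ μ t := by
          rw [integral_sub (hint t x) (integrable_const _)]
          simp
        rw [h3, ← Real.norm_eq_abs]
        refine le_trans (norm_integral_le_of_norm_le (g := ψ)
          (Integrable.of_bound hψc.aestronglyMeasurable _ (Eventually.of_forall hψb))
          (Eventually.of_forall fun y => ?_)) (hsmall₁ t ht.le (htt.trans (min_le_left _ _)))
        refine le_min ?_ (by simpa using hfLip' (x + y) x)
        have h4 := abs_sub (f (x + y)) (f x)
        rw [Real.norm_eq_abs]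
        linarith [hfb (x + y), hfb x]
      have h5 := abs_sub_le (∫ y, f (T t x + y) ∂ μ t) (∫ y, f (x + y) ∂ μ t) (f x)
      have h6 : 0 ≤ 2 * C / t₀ * t := by positivity
      linarith
    · have h1 := abs_sub (∫ y, f (T t x + y) ∂ μ t) (f x)
      have h2 : 2 * C ≤ 2 * C / t₀ * t := by
        rw [div_mul_eq_mul_div, le_div_iff₀ ht₀pos]
        gcongr
      linarith [hfC t (T t x), hfb x]
  · have h1 : 2 * C / t₀ / α ≤ ε / 2 := by
      rw [div_le_iff₀ (by positivity)] at hα2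
      rw [div_div, div_le_iff₀ (by positivity)]
      linarith
    linarith
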